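/- There exists a strategy for Ann that allows her to win the non-repetitive game of any length on an alphabet of 7 letters when Ben moves first. Precisely: there exists a function s : List (Fin 7) → Fin 7 (Ann's strategy) such that for every function b : List (Fin 7) → Fin 7 (Ben's moves) and every n : ℕ, the word w_n defined by w_0 = [] and w_{k+1} = w_k ++ [b w_k] if k is even, w_{k+1} = w_k ++ [s w_k] if k is odd, contains no non-trivial square, i.e., there is no word u with u.length ≥ 2 such that u ++ u is a factor (contiguous sublist) of w_n. -/

import Mathlib

/-- The word built in the non-repetitive game where Ben (moves given by `b`)
moves at even steps and Ann (strategy `s`) moves at odd steps. -/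
def gameWordBenFirst (s b : List (Fin 7) → Fin 7) : ℕ → List (Fin 7)
  | 0 => []
  | k + 1 =>
      gameWordBenFirst s b k ++
        [if k % 2 = 0 then b (gameWordBenFirst s b k) else s (gameWordBenFirst s b k)]

namespace NRG

/-- Ann's letters form a square of period `p` at the end (newest letter first). -/
def EvenBad (p : ℕ) (v : List (Fin 7)) : Prop := ∀ i < p, v[2 * i]? = v[2 * i + 2 * p]?

/-- The last `2p` letters repeat at distance `2p+1`. -/
def OddBad (p : ℕ) (v : List (Fin 7)) : Prop := ∀ i < 2 * p, v[i]? = v[i + 2 * p + 1]?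

def Bad (v : List (Fin 7)) : Prop := ∃ p, 1 ≤ p ∧ (EvenBad p v ∨ OddBad p v)

def Good : ℕ → List (Fin 7) → Prop
  | 0, _ => True
  | n + 1, v => ∀ b, ∃ a, ¬ Bad (a :: b :: v) ∧ Good n (a :: b :: v)

def play (β : List (Fin 7) → Fin 7) : List (Fin 7) → List (Fin 7)
  | [] => []
  | x :: a => x :: β (play β a) :: play β a

lemma play_length (β) (a : List (Fin 7)) : (play β a).length = 2 * a.length := by
  induction a with
  | nil => rfl
  | cons x a ih => simp [play, ih]; omega

lemma play_even (β) (a : List (Fin 7)) : ∀ i, (play β a)[2 * i]? = a[i]? := by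
  induction a with
  | nil => intro i; simp [play]
  | cons x a ih =>
    intro i
    cases i with
    | zero => simp [play]
    | succ i =>
      rw [show 2 * (i + 1) = 2 * i + 1 + 1 by ring]
      simp [play, ih]

lemma play_drop (β) (p : ℕ) : ∀ a : List (Fin 7), play β (a.drop p) = (play β a).drop (2 * p) := by
  induction p with
  | zero => intro a; simp
  | succ p ih =>
    intro a
    cases a with
    | nil => simp [play]
    | cons x a =>
      rw [show 2 * (p + 1) = 2 * p + 1 + 1 by ring]
      simp [play, ih]

open Classical in
noncomputable def ext1 (S : Finset (List (Fin 7))) : Finset (List (Fin 7)) :=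
  (Finset.univ ×ˢ S).image (fun q : Fin 7 × List (Fin 7) => q.1 :: q.2)

lemma card_ext1 (S) : (ext1 S).card = 7 * S.card := by
  classical
  unfold ext1
  rw [Finset.card_image_of_injective]
  · simp
  · rintro ⟨x, a⟩ ⟨y, b⟩ h; simpa using h

lemma mem_ext1 {S : Finset (List (Fin 7))} {l} : l ∈ ext1 S ↔ ∃ x a, a ∈ S ∧ l = x :: a := by
  simp only [ext1, Finset.mem_image, Finset.mem_product, Finset.mem_univ, true_and, Prod.exists]
  constructor
  · rintro ⟨x, a, h, rfl⟩; exact ⟨x, a, h, rfl⟩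
  · rintro ⟨x, a, h, rfl⟩; exact ⟨x, a, h, rfl⟩

open Classical in
noncomputable def G (β : List (Fin 7) → Fin 7) : ℕ → Finset (List (Fin 7))
  | 0 => {[]}
  | k + 1 => (ext1 (G β k)).filter (fun a => ¬ Bad (play β a))

lemma mem_G_succ {β k l} : l ∈ G β (k + 1) ↔
    (∃ x a, a ∈ G β k ∧ l = x :: a) ∧ ¬ Bad (play β l) := by
  simp [G, mem_ext1]

lemma G_length {β} : ∀ {k l}, l ∈ G β k → l.length = k := by
  intro k
  induction k with
  | zero => intro l h; simp [G] at h; simp [h]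
  | succ k ih =>
    intro l h
    obtain ⟨⟨x, a, ha, rfl⟩, -⟩ := mem_G_succ.1 h
    simp [ih ha]

lemma G_drop {β} (p : ℕ) : ∀ {j l}, l ∈ G β (j + p) → l.drop p ∈ G β j := by
  induction p with
  | zero => intro j l h; simpa using h
  | succ p ih =>
    intro j l h
    obtain ⟨⟨x, a, ha, rfl⟩, -⟩ := mem_G_succ.1 (show l ∈ G β ((j + p) + 1) from h)
    simpa using ih ha

lemma even_inj {β} {p : ℕ} {a a' : List (Fin 7)} (h : EvenBad p (play β a))
    (h' : EvenBad p (play β a')) (e : a.drop p = a'.drop p) : a = a' := by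
  apply List.ext_getElem?
  intro i
  by_cases hi : i < p
  · have e2 := congrArg (fun l : List (Fin 7) => l[i]?) e
    simp only [List.getElem?_drop] at e2
    have h1 := h i hi
    have h2 := h' i hi
    rw [← mul_add, play_even, play_even] at h1 h2
    rw [h1, h2, add_comm i p, e2]
  · have e2 := congrArg (fun l : List (Fin 7) => l[i - p]?) e
    simp only [List.getElem?_drop] at e2
    rwa [show p + (i - p) = i by omega] at e2

lemma odd_inj {β} {p : ℕ} {a a' : List (Fin 7)} (h : OddBad p (play β a))
    (h' : OddBad p (play β a')) (e : a.drop p = a'.drop p) : a = a' := by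
  apply List.ext_getElem?
  intro i
  by_cases hi : i < p
  · have e2 := congrArg (fun l : List (Fin 7) => (play β l)[2 * i + 1]?) e
    simp only [play_drop, List.getElem?_drop] at e2
    have h1 := h (2 * i) (by omega)
    have h2 := h' (2 * i) (by omega)
    rw [play_even] at h1 h2
    rw [h1, h2, show 2 * i + 2 * p + 1 = 2 * p + (2 * i + 1) by ring, e2]
  · have e2 := congrArg (fun l : List (Fin 7) => l[i - p]?) e
    simp only [List.getElem?_drop] at e2
    rwa [show p + (i - p) = i by omega] at e2

lemma card_step (β) (k : ℕ) :
    7 * (G β k).card ≤ (G β (k + 1)).card + 2 * ∑ j ∈ Finset.range (k + 1), (G β j).card := by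
  classical
  set E : ℕ → Finset (List (Fin 7)) := fun j =>
    (ext1 (G β k)).filter (fun a => EvenBad (k + 1 - j) (play β a))
  set O : ℕ → Finset (List (Fin 7)) := fun j =>
    (ext1 (G β k)).filter (fun a => OddBad (k + 1 - j) (play β a))
  have hdrop : ∀ j ∈ Finset.range (k + 1), ∀ l ∈ ext1 (G β k),
      l.drop (k + 1 - j) ∈ G β j := by
    intro j hj l hl
    rw [Finset.mem_range] at hj
    obtain ⟨x, a, ha, rfl⟩ := mem_ext1.1 hl
    rw [show k + 1 - j = (k - j) + 1 by omega, List.drop_succ_cons]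
    apply G_drop
    rwa [show j + (k - j) = k by omega]
  have hE : ∀ j ∈ Finset.range (k + 1), (E j).card ≤ (G β j).card := by
    intro j hj
    apply Finset.card_le_card_of_injOn (fun l => l.drop (k + 1 - j))
    · intro l hl
      exact hdrop j hj l (Finset.mem_filter.1 hl).1
    · intro l hl l' hl' e
      exact even_inj (Finset.mem_filter.1 hl).2 (Finset.mem_filter.1 hl').2 e
  have hO : ∀ j ∈ Finset.range (k + 1), (O j).card ≤ (G β j).card := by
    intro j hj
    apply Finset.card_le_card_of_injOn (fun l => l.drop (k + 1 - j))
    · intro l hl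
      exact hdrop j hj l (Finset.mem_filter.1 hl).1
    · intro l hl l' hl' e
      exact odd_inj (Finset.mem_filter.1 hl).2 (Finset.mem_filter.1 hl').2 e
  have hsub : ext1 (G β k) ⊆ G β (k + 1) ∪ (Finset.range (k + 1)).biUnion (fun j => E j ∪ O j) := by
    intro l hl
    by_cases hb : Bad (play β l)
    · apply Finset.mem_union_right
      have hlen : (play β l).length = 2 * (k + 1) := by
        obtain ⟨x, a, ha, rfl⟩ := mem_ext1.1 hl
        rw [play_length]; simp [G_length ha]
      obtain ⟨p, hp, h⟩ := hb
      have hpk : p ≤ k + 1 := by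
        by_contra hc
        have h0 : (play β l)[0]? ≠ none := by
          rw [Ne, List.getElem?_eq_none_iff]; omega
        rcases h with h | h
        · have := h 0 (by omega)
          rw [List.getElem?_eq_none (i := 2 * 0 + 2 * p) (by omega)] at this
          exact h0 this
        · have := h 0 (by omega)
          rw [List.getElem?_eq_none (i := 0 + 2 * p + 1) (by omega)] at this
          exact h0 this
      rw [Finset.mem_biUnion]
      refine ⟨k + 1 - p, by rw [Finset.mem_range]; omega, ?_⟩
      have e : k + 1 - (k + 1 - p) = p := by omega
      simp only [E, O, Finset.mem_union, Finset.mem_filter, e]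
      tauto
    · apply Finset.mem_union_left
      exact mem_G_succ.2 ⟨mem_ext1.1 hl, hb⟩
  calc 7 * (G β k).card = (ext1 (G β k)).card := (card_ext1 _).symm
    _ ≤ _ := Finset.card_le_card hsub
    _ ≤ _ := Finset.card_union_le _ _
    _ ≤ _ := by
      gcongr
      refine Finset.card_biUnion_le.trans ?_
      rw [Finset.mul_sum]
      apply Finset.sum_le_sum
      intro j hj
      have := Finset.card_union_le (E j) (O j)
      have := hE j hj
      have := hO j hj
      omega

lemma card_sum (β) (k : ℕ) : 1 ≤ (G β k).card ∧
    2 * ∑ j ∈ Finset.range (k + 1), (G β j).card ≤ 3 * (G β k).card := by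
  induction k with
  | zero => simp [G]
  | succ k ih =>
    have := card_step β k
    rw [Finset.sum_range_succ]
    omega

lemma good_nil (n : ℕ) : Good n [] := by
  classical
  by_contra hn
  let β : List (Fin 7) → Fin 7 := fun v =>
    if h : ∃ b, ∀ a, ¬ Bad (a :: b :: v) → ¬ Good (n - v.length / 2 - 1) (a :: b :: v)
    then h.choose else 0
  have key : ∀ k ≤ n, ∀ l ∈ G β k, ¬ Good (n - k) (play β l) := by
    intro k
    induction k with
    | zero => intro _ l hl; simp [G] at hl; subst hl; simpa [play] using hn
    | succ k ih =>
      intro hk l hl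
      obtain ⟨⟨x, a, ha, rfl⟩, hb⟩ := mem_G_succ.1 hl
      have h1 := ih (by omega) a ha
      rw [show n - k = (n - (k + 1)) + 1 by omega] at h1
      simp only [Good] at h1
      push Not at h1
      have hlen : n - (play β a).length / 2 - 1 = n - (k + 1) := by
        rw [play_length, G_length ha]; omega
      have hex : ∃ b, ∀ x, ¬ Bad (x :: b :: play β a) →
          ¬ Good (n - (play β a).length / 2 - 1) (x :: b :: play β a) := by
        rw [hlen]; exact h1
      have hβ : β (play β a) = hex.choose := dif_pos hex
      have := hex.choose_spec x
      rw [← hβ, hlen] at this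
      exact this hb
  obtain ⟨l, hl⟩ := Finset.card_pos.1 (card_sum β n).1
  have := key n le_rfl l hl
  simp [Good] at this

lemma good_mono {n : ℕ} : ∀ {m v}, m ≤ n → Good n v → Good m v := by
  induction n with
  | zero => intro m v h hg; rw [Nat.le_zero.1 h]; exact hg
  | succ n ih =>
    intro m v h hg
    cases m with
    | zero => trivial
    | succ m =>
      intro b
      obtain ⟨a, h1, h2⟩ := hg b
      exact ⟨a, h1, ih (by omega) h2⟩

def Win (v : List (Fin 7)) : Prop := ∀ n, Good n v

lemma win_step {v} (h : Win v) (b : Fin 7) : ∃ a, ¬ Bad (a :: b :: v) ∧ Win (a :: b :: v) := by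
  by_contra hc
  push Not at hc
  have h1 : ∀ a, ∃ n, ¬ Bad (a :: b :: v) → ¬ Good n (a :: b :: v) := by
    intro a
    by_cases hb : Bad (a :: b :: v)
    · exact ⟨0, fun h => absurd hb h⟩
    · have := hc a hb
      simp only [Win, not_forall] at this
      obtain ⟨n, hn⟩ := this
      exact ⟨n, fun _ => hn⟩
  choose f hf using h1
  obtain ⟨a, ha, hg⟩ := h (Finset.univ.sup f + 1) b
  exact hf a ha (good_mono (Finset.le_sup (Finset.mem_univ a)) hg)

open Classical in
noncomputable def strat (w : List (Fin 7)) : Fin 7 :=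
  if h : ∃ a, ¬ Bad (a :: w.reverse) ∧ Win (a :: w.reverse) then h.choose else 0

lemma game_win (b) (k : ℕ) : Win (gameWordBenFirst strat b (2 * k)).reverse ∧
    (1 ≤ k → ¬ Bad (gameWordBenFirst strat b (2 * k)).reverse) := by
  induction k with
  | zero => exact ⟨fun n => good_nil n, fun h => by omega⟩
  | succ k ih =>
    set w := gameWordBenFirst strat b (2 * k) with hw
    have e1 : gameWordBenFirst strat b (2 * k + 1) = w ++ [b w] := by
      rw [gameWordBenFirst, if_pos (by omega)]
    have e2 : gameWordBenFirst strat b (2 * (k + 1)) = (w ++ [b w]) ++ [strat (w ++ [b w])] := by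
      rw [show 2 * (k + 1) = (2 * k + 1) + 1 by ring, gameWordBenFirst, if_neg (by omega), e1]
    have hex : ∃ a, ¬ Bad (a :: (w ++ [b w]).reverse) ∧ Win (a :: (w ++ [b w]).reverse) := by
      simpa using win_step ih.1 (b w)
    have hs : strat (w ++ [b w]) = hex.choose := dif_pos hex
    have := hex.choose_spec
    rw [← hs] at this
    rw [e2, List.reverse_append (as := w ++ [b w])]
    exact ⟨this.2, fun _ => this.1⟩

lemma game_length (s b) (n : ℕ) : (gameWordBenFirst s b n).length = n := by
  induction n with
  | zero => rfl
  | succ n ih => rw [gameWordBenFirst]; simp [ih]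

lemma game_prefix (s b) (m d : ℕ) :
    gameWordBenFirst s b m <+: gameWordBenFirst s b (m + d) := by
  induction d with
  | zero => simp
  | succ d ih =>
    rw [← add_assoc, gameWordBenFirst]
    exact ih.trans (List.prefix_append _ _)

lemma sq_period (u r : List (Fin 7)) (i : ℕ) (hi : i < u.length) :
    (u ++ (u ++ r))[i]? = (u ++ (u ++ r))[i + u.length]? := by
  rw [List.getElem?_append_left hi, List.getElem?_append_right (by omega),
    Nat.add_sub_cancel, List.getElem?_append_left hi]

end NRG

open NRG in
/-- There is a strategy for Ann (moving second) that wins the non-repetitive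
game of any length over a 7-letter alphabet: the produced word never contains
a non-trivial square `u ++ u` with `u.length ≥ 2` as a factor. -/
theorem ann_wins_nonrepetitive_game_seven_letters_ben_first :
    ∃ s : List (Fin 7) → Fin 7, ∀ b : List (Fin 7) → Fin 7, ∀ n : ℕ,
      ¬ ∃ u : List (Fin 7), 2 ≤ u.length ∧
          ∃ p q : List (Fin 7), gameWordBenFirst s b n = p ++ (u ++ u) ++ q := by
  refine ⟨strat, ?_⟩
  rintro b n ⟨u, hu, p, q, hw⟩
  obtain ⟨m, hm⟩ : ∃ m, m = (p ++ (u ++ u)).length := ⟨_, rfl⟩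
  have hn : n = m + q.length := by
    have := congrArg List.length hw
    rw [game_length, List.length_append] at this
    omega
  have hm2 : m = p.length + 2 * u.length := by rw [hm]; simp; omega
  have hwm : gameWordBenFirst strat b m = p ++ (u ++ u) := by
    have h1 := game_prefix strat b m q.length
    rw [← hn, hw] at h1
    exact (List.prefix_of_prefix_length_le h1 (List.prefix_append _ _)
      (by rw [game_length, hm])).eq_of_length (by rw [game_length, hm])
  have hx : (gameWordBenFirst strat b m).reverse = u.reverse ++ (u.reverse ++ p.reverse) := by
    rw [hwm]; simp
  have hper : ∀ i < u.length, (gameWordBenFirst strat b m).reverse[i]? =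
      (gameWordBenFirst strat b m).reverse[i + u.length]? := by
    intro i hi
    have := sq_period u.reverse p.reverse i (by simpa using hi)
    rw [hx]; simpa using this
  rcases Nat.even_or_odd' m with ⟨k, hk | hk⟩
  · apply (game_win b k).2 (by omega)
    rw [← hk]
    rcases Nat.even_or_odd' u.length with ⟨t, ht | ht⟩
    · refine ⟨t, by omega, Or.inl fun i hi => ?_⟩
      rw [hper _ (by omega), ht]
    · refine ⟨t, by omega, Or.inr fun i hi => ?_⟩
      rw [hper _ (by omega), ht, add_assoc]
  · apply (game_win b k).2 (by omega)
    have hs : ∀ i : ℕ, (gameWordBenFirst strat b (2 * k)).reverse[i]? =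
        (gameWordBenFirst strat b m).reverse[i + 1]? := by
      intro i
      rw [hk, gameWordBenFirst]; simp
    rcases Nat.even_or_odd' u.length with ⟨t, ht | ht⟩
    · refine ⟨t, by omega, Or.inl fun i hi => ?_⟩
      rw [hs, hs, hper _ (by omega), ht]
      congr 1; omega
    · refine ⟨t, by omega, Or.inr fun i hi => ?_⟩
      rw [hs, hs, hper _ (by omega), ht]
      congr 1; omega
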